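/- Let $T > 0$ and $C_* > 0$. There exist $C_1 > 0$ and $h_0 \in (0,1)$, depending only on $C_*$ and $T$, with the following property: for every $h \in (0, h_0)$, every positive integer $N$ with $\tau = T/N$, and all sequences of nonnegative real numbers $(a_n)_{n=0}^N$ and $(d_n)_{n=1}^N$ satisfying $a_0 = 0$, $\sum_{n=1}^N \tau\, d_n \le C_*$, and $(a_{n+1}^2 - a_n^2)/\tau \le C_*\bigl(a_n^2 + h^{-1} a_n^4\bigr) + C_* h^3 + d_{n+1}\, h^4$ for all $0 \le n \le N-1$, one has $a_n \le h^{1/2}$ for all $0 \le n \le N$, and moreover $\max_{0 \le n \le N} a_n^2 \le C_1 h^3$. -/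

import Mathlib

/-- Discrete Grönwall inequality with a conditional recursion: if `b (n + 1) ≤ (1 + q) b n + g (n + 1)`
holds as long as `b n ≤ M`, and `M` dominates the resulting Grönwall bound, then the bound holds. -/
theorem gronwall_of_le_imp {q M : ℝ} (hq : 0 ≤ q) {N : ℕ} {b g : ℕ → ℝ}
    (hg : ∀ n, 1 ≤ n → n ≤ N → 0 ≤ g n) (hb0 : b 0 = 0)
    (hM : Real.exp (q * N) * ∑ k ∈ Finset.Icc 1 N, g k ≤ M)
    (hstep : ∀ n, n < N → b n ≤ M → b (n + 1) ≤ (1 + q) * b n + g (n + 1))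
    (hb : ∀ n, n ≤ N → 0 ≤ b n) :
    ∀ n, n ≤ N → b n ≤ M := by
  have hsum_nonneg : ∀ n, n ≤ N → 0 ≤ ∑ k ∈ Finset.Icc 1 n, g k := fun n hn =>
    Finset.sum_nonneg fun k hk => by
      rw [Finset.mem_Icc] at hk
      exact hg k hk.1 (hk.2.trans hn)
  have hle : ∀ n, n ≤ N → Real.exp (q * n) * ∑ k ∈ Finset.Icc 1 n, g k ≤ M := by
    intro n hn
    refine le_trans (mul_le_mul ?_ ?_ (hsum_nonneg n hn) (Real.exp_pos _).le) hM
    · gcongr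
    · refine Finset.sum_le_sum_of_subset_of_nonneg (Finset.Icc_subset_Icc_right hn) ?_
      intro k hk _
      rw [Finset.mem_Icc] at hk
      exact hg k hk.1 hk.2
  have key : ∀ n, n ≤ N → b n ≤ Real.exp (q * n) * ∑ k ∈ Finset.Icc 1 n, g k := by
    intro n
    induction n with
    | zero => intro _; simp [hb0]
    | succ n ih =>
      intro hn
      have hn' : n ≤ N := by omega
      have h1 := ih hn'
      have h2 := hstep n (by omega) (h1.trans (hle n hn'))
      have h3 : 1 + q ≤ Real.exp q := by linarith [Real.add_one_le_exp q]
      have h4 : (1 + q) * b n ≤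
          Real.exp q * (Real.exp (q * n) * ∑ k ∈ Finset.Icc 1 n, g k) :=
        mul_le_mul h3 h1 (hb n hn') (Real.exp_pos _).le
      have h5 : Real.exp (q * (n + 1 : ℕ)) = Real.exp q * Real.exp (q * n) := by
        rw [← Real.exp_add]
        push_cast
        ring_nf
      have h6 : 1 ≤ Real.exp (q * (n + 1 : ℕ)) := Real.one_le_exp (by positivity)
      have h7 := le_mul_of_one_le_left (hg (n + 1) (by omega) hn) h6
      rw [Finset.sum_Icc_succ_top (by omega), mul_add]
      rw [h5] at h7 ⊢
      linarith
  exact fun n hn => (key n hn).trans (hle n hn)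

/-- Induction bootstrap for the fully-discrete error: there are `C₁ > 0` and `h₀ ∈ (0,1)`
depending only on `C⋆, T` such that whenever `0 < h < h₀`, `τ = T/N`, `a 0 = 0`,
`∑ τ d n ≤ C⋆`, and `(a(n+1)² - a n²)/τ ≤ C⋆ (a n² + h⁻¹ a n⁴) + C⋆ h³ + d(n+1) h⁴`
for `n < N`, then `a n ≤ h^(1/2)` for all `n ≤ N` and `max_n a n² ≤ C₁ h³`. -/
theorem fully_discrete_bootstrap
    (T Cs : ℝ) (hT : 0 < T) (hCs : 0 < Cs) :
    ∃ C₁ > 0, ∃ h₀ : ℝ, 0 < h₀ ∧ h₀ < 1 ∧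
      ∀ h : ℝ, 0 < h → h < h₀ → ∀ (N : ℕ), 0 < N → ∀ τ : ℝ, τ = T / N →
        ∀ a d : ℕ → ℝ,
          (∀ n, n ≤ N → 0 ≤ a n) →
          (∀ n, 1 ≤ n → n ≤ N → 0 ≤ d n) →
          a 0 = 0 →
          (∑ n ∈ Finset.Icc 1 N, τ * d n ≤ Cs) →
          (∀ n, n < N →
            (a (n + 1) ^ 2 - a n ^ 2) / τ ≤
              Cs * (a n ^ 2 + h⁻¹ * a n ^ 4) + Cs * h ^ 3 + d (n + 1) * h ^ 4) →
          (∀ n, n ≤ N → a n ≤ h ^ ((1 : ℝ) / 2)) ∧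
          (∀ n, n ≤ N → a n ^ 2 ≤ C₁ * h ^ 3) := by
  set C₁ : ℝ := Real.exp (2 * Cs * T) * (Cs * T + Cs) with hC₁
  have hC₁pos : 0 < C₁ := by positivity
  refine ⟨C₁, hC₁pos, 1 / (C₁ + 1), by positivity, ?_, ?_⟩
  · rw [div_lt_one (by positivity)]
    linarith
  intro h hh hlt N hN τ hτ a d ha hd ha0 hsum hrec
  have hNpos : (0 : ℝ) < N := by exact_mod_cast hN
  have hτpos : 0 < τ := by rw [hτ]; positivity
  have hτN : τ * N = T := by rw [hτ]; field_simp
  have hprod : h * (C₁ + 1) < 1 := (lt_div_iff₀ (by positivity)).1 hlt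
  have hC₁h : C₁ * h ≤ 1 := by nlinarith
  have hh1 : h ≤ 1 := by nlinarith
  have hMh : C₁ * h ^ 3 ≤ h := by
    calc C₁ * h ^ 3 = (C₁ * h) * (h * h) := by ring
      _ ≤ 1 * (h * 1) := by gcongr
      _ = h := by ring
  have hbound : ∀ n, n ≤ N → a n ^ 2 ≤ C₁ * h ^ 3 := by
    refine gronwall_of_le_imp (q := 2 * Cs * τ) (b := fun n => a n ^ 2)
      (g := fun n => τ * (Cs * h ^ 3) + h ^ 4 * (τ * d n)) (by positivity)
      ?_ (by simp [ha0]) ?_ ?_ (fun n _ => sq_nonneg _)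
    · intro n h1 h2
      have := hd n h1 h2
      positivity
    · rw [mul_assoc (2 * Cs), hτN, Finset.sum_add_distrib, ← Finset.mul_sum _ _ (h ^ 4), hC₁,
        mul_assoc (Real.exp _)]
      refine mul_le_mul_of_nonneg_left ?_ (Real.exp_pos _).le
      have h4 : h ^ 4 ≤ h ^ 3 := pow_le_pow_of_le_one hh.le hh1 (by norm_num)
      have h5 : h ^ 4 * ∑ n ∈ Finset.Icc 1 N, τ * d n ≤ h ^ 3 * Cs :=
        (mul_le_mul_of_nonneg_left hsum (by positivity)).trans
          (mul_le_mul_of_nonneg_right h4 hCs.le)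
      simp only [Finset.sum_const, Nat.card_Icc, add_tsub_cancel_right, nsmul_eq_mul]
      rw [← hτN]
      linarith
    · intro n hn hbn
      have h1 := hrec n hn
      rw [div_le_iff₀ hτpos] at h1
      have h2 : h⁻¹ * a n ^ 4 ≤ a n ^ 2 := by
        rw [inv_mul_le_iff₀ hh]
        calc a n ^ 4 = a n ^ 2 * a n ^ 2 := by ring
          _ ≤ h * a n ^ 2 := mul_le_mul_of_nonneg_right (hbn.trans hMh) (sq_nonneg _)
      have h3 := mul_le_mul_of_nonneg_left h2 (mul_pos hCs hτpos).le
      linarith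
  refine ⟨fun n hn => ?_, hbound⟩
  rw [← Real.sqrt_eq_rpow]
  exact Real.le_sqrt_of_sq_le ((hbound n hn).trans hMh)
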